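/- arXiv:2503.00687 — 2 statements merged into one kernel-verified Lean document; each statement's English description precedes it below -/
import Mathlib

section
/- Let q : ℝ → ℝ be a quadratic polynomial, q(λ) = aλ + bλ² for real a, b, satisfying q(0) = 0 and λ ≤ q(λ) ≤ 1 for all λ ∈ [0,1]. Then q(λ) ≤ 2λ − λ² for all λ ∈ [0,1]. Moreover, the polynomial p̂(λ) = 2λ − λ² itself satisfies λ ≤ p̂(λ) ≤ 1 for all λ ∈ [0,1]. -/
/-- Optimality of the twicing polynomial among quadratics: if `q(λ) = aλ + bλ²`
satisfies `q(0) = 0` and `λ ≤ q(λ) ≤ 1` on `[0,1]`, then `q(λ) ≤ 2λ - λ²` on `[0,1]`;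
moreover `p̂(λ) = 2λ - λ²` itself satisfies `λ ≤ p̂(λ) ≤ 1` on `[0,1]`. -/
theorem twicing_poly_optimal (a b : ℝ)
    (h0 : a * 0 + b * 0 ^ 2 = 0)
    (hq : ∀ x ∈ Set.Icc (0:ℝ) 1, x ≤ a * x + b * x ^ 2 ∧ a * x + b * x ^ 2 ≤ 1) :
    (∀ x ∈ Set.Icc (0:ℝ) 1, a * x + b * x ^ 2 ≤ 2 * x - x ^ 2) ∧
    (∀ x ∈ Set.Icc (0:ℝ) 1, x ≤ 2 * x - x ^ 2 ∧ 2 * x - x ^ 2 ≤ 1) := by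
  have hab : b = 1 - a := by
    have h1 := hq 1 (by simp)
    linarith [h1.1, h1.2]
  subst hab
  -- If `2 < a`, the maximum of `q` lies in `(0, 1)` and exceeds `1`.
  have ha : a ≤ 2 := by
    by_contra! h
    have hpos : 0 < 2 * (a - 1) := by linarith
    have hv := (hq (a / (2 * (a - 1)))
      ⟨by positivity, by rw [div_le_one hpos]; linarith⟩).2
    have hval : a * (a / (2 * (a - 1))) + (1 - a) * (a / (2 * (a - 1))) ^ 2 - 1
        = (a - 2) ^ 2 / (4 * (a - 1)) := by
      have hne : a - 1 ≠ 0 := by linarith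
      field_simp
      ring
    have hgt : 0 < (a - 2) ^ 2 / (4 * (a - 1)) :=
      div_pos (pow_pos (by linarith) 2) (by linarith)
    linarith
  refine ⟨fun x ⟨hx0, hx1⟩ => ?_, fun x ⟨hx0, hx1⟩ => ⟨?_, ?_⟩⟩
  · nlinarith [mul_nonneg (sub_nonneg.2 ha) (mul_nonneg hx0 (sub_nonneg.2 hx1))]
  · nlinarith [mul_nonneg hx0 (sub_nonneg.2 hx1)]
  · nlinarith [sq_nonneg (1 - x)]
end

section
/- Let K : ℝ → ℝ be integrable with ∫_ℝ K(u) du = 1, zero first moment ∫_ℝ u K(u) du = 0, and finite second absolute moment ∫_ℝ u² |K(u)| du < ∞. Then the twicing kernel K̂ = 2K − K∗K has vanishing second moment: μ₂(K̂) = ∫_ℝ u² (2K(u) − (K∗K)(u)) du = 0. -/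
open MeasureTheory

/-- A function with finite zeroth and second absolute moments has finite first absolute moment. -/
lemma integrable_id_mul_of_integrable_sq_mul {f : ℝ → ℝ} (hf : Integrable f)
    (hf2 : Integrable (fun u => u ^ 2 * f u)) : Integrable (fun u => u * f u) := by
  refine (hf.norm.add hf2.norm).mono'
    (continuous_id.aestronglyMeasurable.mul hf.aestronglyMeasurable) (.of_forall fun u => ?_)
  simp only [Pi.add_apply, norm_mul, norm_pow, Real.norm_eq_abs]
  nlinarith [mul_nonneg (abs_nonneg (f u)) (sq_nonneg (|u| - 1)), abs_nonneg (f u),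
    mul_nonneg (abs_nonneg (f u)) (sq_nonneg |u|)]

/-- Binomial decomposition of `u ^ 2 * (f ∗ g) u` into convolutions of moment-weighted functions. -/
lemma sq_mul_convolution_ae_eq {f g : ℝ → ℝ} (hf : Integrable f) (hg : Integrable g)
    (hf2 : Integrable (fun u => u ^ 2 * f u)) (hg2 : Integrable (fun u => u ^ 2 * g u)) :
    (fun u => u ^ 2 * ∫ v, f v * g (u - v)) =ᵐ[volume] fun u =>
      convolution (fun v => v ^ 2 * f v) g (ContinuousLinearMap.mul ℝ ℝ) volume u +
      2 * convolution (fun v => v * f v) (fun v => v * g v)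
        (ContinuousLinearMap.mul ℝ ℝ) volume u +
      convolution f (fun v => v ^ 2 * g v) (ContinuousLinearMap.mul ℝ ℝ) volume u := by
  have hf1 := integrable_id_mul_of_integrable_sq_mul hf hf2
  have hg1 := integrable_id_mul_of_integrable_sq_mul hg hg2
  filter_upwards [hf2.ae_convolution_exists (ContinuousLinearMap.mul ℝ ℝ) hg,
    hf1.ae_convolution_exists (ContinuousLinearMap.mul ℝ ℝ) hg1,
    hf.ae_convolution_exists (ContinuousLinearMap.mul ℝ ℝ) hg2] with u h20 h11 h02
  have h20 := h20.integrable
  have h11 := (h11.integrable).const_mul 2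
  have h02 := h02.integrable
  simp only [convolution]
  rw [← integral_const_mul, ← integral_const_mul, ← integral_add h20 h11,
    ← integral_add (h20.fun_add h11) h02]
  refine integral_congr_ae (.of_forall fun v => ?_)
  simp only [ContinuousLinearMap.mul_apply']
  ring

/-- `u ^ 2 * (f ∗ g) u` is integrable when `f` and `g` have finite second absolute moments. -/
lemma integrable_sq_mul_convolution {f g : ℝ → ℝ} (hf : Integrable f) (hg : Integrable g)
    (hf2 : Integrable (fun u => u ^ 2 * f u)) (hg2 : Integrable (fun u => u ^ 2 * g u)) :
    Integrable (fun u => u ^ 2 * ∫ v, f v * g (u - v)) := by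
  have hf1 := integrable_id_mul_of_integrable_sq_mul hf hf2
  have hg1 := integrable_id_mul_of_integrable_sq_mul hg hg2
  exact (((hf2.integrable_convolution _ hg).add
    ((hf1.integrable_convolution _ hg1).const_mul 2)).add
    (hf.integrable_convolution _ hg2)).congr (sq_mul_convolution_ae_eq hf hg hf2 hg2).symm

/-- The second moment of a convolution in terms of the moments of its factors. -/
lemma integral_sq_mul_convolution {f g : ℝ → ℝ} (hf : Integrable f) (hg : Integrable g)
    (hf2 : Integrable (fun u => u ^ 2 * f u)) (hg2 : Integrable (fun u => u ^ 2 * g u)) :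
    ∫ u, u ^ 2 * ∫ v, f v * g (u - v) =
      (∫ u, u ^ 2 * f u) * (∫ u, g u) + 2 * ((∫ u, u * f u) * ∫ u, u * g u) +
        (∫ u, f u) * ∫ u, u ^ 2 * g u := by
  have hf1 := integrable_id_mul_of_integrable_sq_mul hf hf2
  have hg1 := integrable_id_mul_of_integrable_sq_mul hg hg2
  have h20 := hf2.integrable_convolution (ContinuousLinearMap.mul ℝ ℝ) hg
  have h11 := (hf1.integrable_convolution (ContinuousLinearMap.mul ℝ ℝ) hg1).const_mul 2
  have h02 := hf.integrable_convolution (ContinuousLinearMap.mul ℝ ℝ) hg2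
  rw [integral_congr_ae (sq_mul_convolution_ae_eq hf hg hf2 hg2),
    integral_add (h20.fun_add h11) h02, integral_add h20 h11, integral_const_mul,
    integral_convolution _ hf2 hg, integral_convolution _ hf1 hg1, integral_convolution _ hf hg2]
  simp only [ContinuousLinearMap.mul_apply']

/-- If `K : ℝ → ℝ` is integrable with `∫ K = 1`, zero first moment and finite second
absolute moment, then the twicing kernel `K̂ = 2K - K∗K` has vanishing second moment:
`μ₂(K̂) = ∫ u² (2K(u) - (K∗K)(u)) du = 0`. -/
theorem twicing_kernel_second_moment (K : ℝ → ℝ) (hK : Integrable K)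
    (hK1 : ∫ u, K u = 1)
    (hm1 : ∫ u, u * K u = 0)
    (hm2 : Integrable (fun u => u ^ 2 * K u)) :
    (∫ u, u ^ 2 * (2 * K u - ∫ v, K v * K (u - v))) = 0 := by
  simp only [mul_sub, mul_left_comm _ (2 : ℝ)]
  rw [integral_sub (hm2.const_mul 2) (integrable_sq_mul_convolution hK hK hm2 hm2),
    integral_const_mul, integral_sq_mul_convolution hK hK hm2 hm2, hK1, hm1]
  ring
end
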